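/- Let (n, θ) be a closed cycle with the θ i not all equal, fix m and even k ≥ 2 as in the run condition, and let f′ be the closed cycle with n − k edges whose lengths are obtained from θ by deleting θ m, θ (m+1), …, θ (m+k−1). Then the folded diameter of f′ equals the folded diameter of (n, θ). -/

import Mathlib

/-- Mountain or valley fold type. -/
inductive MV
  | mountain
  | valley
deriving DecidableEq

/-- Designation of a face as interior or exterior. -/
inductive Des
  | interior
  | exterior
deriving DecidableEq

/-- The sign `ε` used at the top layer: `-1` for an interior face, `+1` for an
exterior face. -/
def epsOf : Des → ℝ
  | Des.interior => -1
  | Des.exterior => 1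

/-- The folded coordinates of a closed cycle: `x 0 = 0` and
`x (i+1) = x i + (-1)^i * θ i`. -/
noncomputable def foldedX (n : ℕ) (θ : ZMod n → ℝ) : ZMod n → ℝ :=
  fun i => ∑ j ∈ Finset.range i.val, (-1 : ℝ) ^ j * θ (j : ZMod n)

/-- `(n, θ)` is a closed cycle: `n` is even, `n ≥ 2`, all edge lengths are
positive, and the alternating sum of the edge lengths is zero. -/
noncomputable def IsClosedCycle (n : ℕ) (θ : ZMod n → ℝ) : Prop :=
  Even n ∧ 2 ≤ n ∧ (∀ i, 0 < θ i) ∧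
    ∑ j ∈ Finset.range n, (-1 : ℝ) ^ j * θ (j : ZMod n) = 0

/-- The open interval whose endpoint set is `{a, b}`. -/
def betw (a b : ℝ) : Set ℝ := Set.Ioo (min a b) (max a b)

/-- `L` is a valid layering of the edges of a cycle folded to coordinates `x`:
`L` is injective; (i) no edge passes strictly between the two edges joined at a
crease at the crease's coordinate; (ii) creases at the same coordinate opening in
the same direction are disjoint or nested. -/
def ValidLayering (n : ℕ) (x L : ZMod n → ℝ) : Prop :=
  Function.Injective L ∧
  (∀ i e : ZMod n, x i ∈ betw (x e) (x (e + 1)) →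
      L e ∉ betw (L (i - 1)) (L i)) ∧
  (∀ i j : ZMod n, i ≠ j → x i = x j →
      Real.sign (x (i + 1) - x i) = Real.sign (x (j + 1) - x j) →
      Disjoint (betw (L (i - 1)) (L i)) (betw (L (j - 1)) (L j)) ∨
        betw (L (i - 1)) (L i) ⊆ betw (L (j - 1)) (L j) ∨
        betw (L (j - 1)) (L j) ⊆ betw (L (i - 1)) (L i))

/-- The layering `L` realizes the MV assignment `μ` with top-layer sign `ε`:
taking `t` to be the index maximizing `L` and `s` the alternating `±1` map with
`s t = ε`, each crease `i` is a valley iff `s (i-1)` equals the sign of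
`L i - L (i-1)`. -/
def Realizes (n : ℕ) (L : ZMod n → ℝ) (μ : ZMod n → MV) (ε : ℝ) : Prop :=
  ∃ t : ZMod n, (∀ j, L j ≤ L t) ∧
    ∃ s : ZMod n → ℝ, (∀ i, s i = 1 ∨ s i = -1) ∧ (∀ i, s (i + 1) = -s i) ∧
      s t = ε ∧
      ∀ i, μ i = MV.valley ↔ s (i - 1) = Real.sign (L i - L (i - 1))

/-- The MV assignment `μ` on the closed cycle `(n, θ)` is flat foldable as a
face with designation `d`: some valid layering of the folded cycle realizes it. -/
noncomputable def FlatFoldable (n : ℕ) (θ : ZMod n → ℝ) (μ : ZMod n → MV)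
    (d : Des) : Prop :=
  ∃ L : ZMod n → ℝ, ValidLayering n (foldedX n θ) L ∧ Realizes n L μ (epsOf d)

/-- The folded diameter of a closed cycle: `max x - min x` over the folded
coordinates. -/
noncomputable def foldedDiameter (n : ℕ) [NeZero n] (θ : ZMod n → ℝ) : ℝ :=
  Finset.univ.sup' ⟨0, Finset.mem_univ 0⟩ (foldedX n θ) -
    Finset.univ.inf' ⟨0, Finset.mem_univ 0⟩ (foldedX n θ)

/-- The edge lengths of the reduced cycle `f'` in the even case: the lengths
`θ m, …, θ (m+k-1)` are deleted, edge `j` of `f'` corresponding to original edge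
`m + k + j`, so that original edges `m - 1` and `m + k` become adjacent. -/
noncomputable def evenShrink (n : ℕ) (θ : ZMod n → ℝ) (m : ZMod n) (k : ℕ) :
    ZMod (n - k) → ℝ :=
  fun j => θ (m + (k : ZMod n) + (j.val : ZMod n))

theorem erd_sup_le {ι κ : Type*} [Fintype ι] [Fintype κ] (a : ι) (b : κ) (f : ι → ℝ) (g : κ → ℝ)
    (h : ∀ i j, ∃ i' j', f i - f j ≤ g i' - g j') :
    Finset.univ.sup' ⟨a, Finset.mem_univ a⟩ f - Finset.univ.inf' ⟨a, Finset.mem_univ a⟩ f ≤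
    Finset.univ.sup' ⟨b, Finset.mem_univ b⟩ g - Finset.univ.inf' ⟨b, Finset.mem_univ b⟩ g := by
  obtain ⟨i, -, hi⟩ := Finset.exists_mem_eq_sup' (s := Finset.univ) ⟨a, Finset.mem_univ a⟩ f
  obtain ⟨j, -, hj⟩ := Finset.exists_mem_eq_inf' (s := Finset.univ) ⟨a, Finset.mem_univ a⟩ f
  obtain ⟨i', j', hij⟩ := h i j
  have h1 := Finset.le_sup' g (Finset.mem_univ i')
  have h2 := Finset.inf'_le g (Finset.mem_univ j')
  rw [hi, hj]
  linarith

theorem erd_val (n : ℕ) [NeZero n] (hn : 2 ≤ n) (a : ZMod n) :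
    (a + 1).val = a.val + 1 ∨ ((a + 1).val = 0 ∧ a.val + 1 = n) := by
  have : Fact (1 < n) := ⟨hn⟩
  have h := ZMod.val_add a 1
  rw [ZMod.val_one] at h
  have h2 := ZMod.val_lt a
  by_cases hc : a.val + 1 = n
  · right; rw [hc, Nat.mod_self] at h; exact ⟨h, hc⟩
  · left; rw [h, Nat.mod_eq_of_lt (by omega)]

theorem erd_step (n : ℕ) [NeZero n] (θ : ZMod n → ℝ) (hcc : IsClosedCycle n θ) (a : ZMod n) :
    foldedX n θ (a + 1) = foldedX n θ a + (-1) ^ a.val * θ a ∧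
    (-1 : ℝ) ^ (a + 1).val = - (-1) ^ a.val := by
  obtain ⟨he, hn, -, hs⟩ := hcc
  have hx : foldedX n θ a + (-1) ^ a.val * θ a
      = ∑ j ∈ Finset.range (a.val + 1), (-1 : ℝ) ^ j * θ (j : ZMod n) := by
    rw [Finset.sum_range_succ, ZMod.natCast_zmod_val]; rfl
  rw [hx]
  rcases erd_val n hn a with h | ⟨h, h'⟩
  · exact ⟨by simp only [foldedX, h], by rw [h, pow_succ]; ring⟩
  · refine ⟨by simp only [foldedX]; rw [h, h', hs]; simp, ?_⟩
    have : (-1 : ℝ) ^ (a.val + 1) = 1 := by rw [h']; exact he.neg_one_pow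
    rw [pow_succ] at this
    rw [h, pow_zero]; linarith

theorem erd_main (n : ℕ) [NeZero n] (θ : ZMod n → ℝ) (hcc : IsClosedCycle n θ) (a : ZMod n)
    (i : ℕ) :
    foldedX n θ (a + i) = foldedX n θ a +
      (-1) ^ a.val * ∑ j ∈ Finset.range i, (-1 : ℝ) ^ j * θ (a + (j : ZMod n)) ∧
    (-1 : ℝ) ^ (a + (i : ZMod n)).val = (-1) ^ a.val * (-1) ^ i := by
  induction i with
  | zero => simp
  | succ i ih =>
    obtain ⟨h1, h2⟩ := erd_step n θ hcc (a + i)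
    have e : a + ((i + 1 : ℕ) : ZMod n) = a + i + 1 := by push_cast; ring
    rw [e, h1, h2, ih.1, ih.2, Finset.sum_range_succ, pow_succ]
    constructor <;> ring

theorem erd_alt (c : ℝ) (hc : 0 ≤ c) (t : ℕ) :
    (Even t → ∑ j ∈ Finset.range t, (-1 : ℝ) ^ j * c = 0) ∧
    0 ≤ ∑ j ∈ Finset.range t, (-1 : ℝ) ^ j * c ∧ ∑ j ∈ Finset.range t, (-1 : ℝ) ^ j * c ≤ c := by
  rw [← Finset.sum_mul, neg_one_geom_sum]
  split_ifs with h <;> simp [h, hc]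

/-- The even-case reduction preserves the folded diameter. -/
theorem even_run_diameter (n : ℕ) [NeZero n] (θ : ZMod n → ℝ)
    (hcc : IsClosedCycle n θ)
    (hne : ∃ i j : ZMod n, θ i ≠ θ j)
    (m : ZMod n) (k : ℕ) [NeZero (n - k)] (hk2 : 2 ≤ k) (hkeven : Even k)
    (hrun₁ : θ m < θ (m - 1))
    (hrun₂ : ∀ j : ℕ, j < k → θ (m + (j : ZMod n)) = θ m)
    (hrun₃ : θ m < θ (m + (k : ZMod n))) :
    foldedDiameter (n - k) (evenShrink n θ m k) = foldedDiameter n θ := by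
  have hn0 : n - k ≠ 0 := NeZero.ne _
  have he := hcc.1
  have hnk : 2 ≤ n - k := by
    obtain ⟨u, hu⟩ := he
    obtain ⟨v, hv⟩ := hkeven
    omega
  have hpos := hcc.2.2.1
  have hrun : ∀ t : ℕ, t ≤ k → foldedX n θ (m + t) = foldedX n θ m +
      (-1) ^ m.val * ∑ j ∈ Finset.range t, (-1 : ℝ) ^ j * θ m := by
    intro t ht
    rw [(erd_main n θ hcc m t).1]
    congr 2
    refine Finset.sum_congr rfl fun j hj => ?_
    rw [hrun₂ j (by have := Finset.mem_range.1 hj; omega)]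
  obtain ⟨a, ha⟩ : ∃ a : ZMod n, a = m + k := ⟨_, rfl⟩
  have hXa : foldedX n θ a = foldedX n θ m := by
    rw [ha, hrun k le_rfl, (erd_alt _ (hpos m).le k).1 hkeven]; simp
  have hsa : (-1 : ℝ) ^ a.val = (-1) ^ m.val := by
    rw [ha, (erd_main n θ hcc m k).2, hkeven.neg_one_pow, mul_one]
  set z := foldedX (n - k) (evenShrink n θ m k) with hz
  have hzv : ∀ i : ZMod (n - k), z i =
      ∑ j ∈ Finset.range i.val, (-1 : ℝ) ^ j * θ (a + (j : ZMod n)) := by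
    intro i
    simp only [hz, foldedX, evenShrink, ha]
    refine Finset.sum_congr rfl fun j hj => ?_
    have h1 := Finset.mem_range.1 hj
    have h2 := ZMod.val_lt i
    rw [ZMod.val_natCast_of_lt (by omega)]
  have hzX : ∀ i : ZMod (n - k), foldedX n θ (a + (i.val : ZMod n)) =
      foldedX n θ a + (-1) ^ a.val * z i := by
    intro i; rw [(erd_main n θ hcc a _).1, hzv]
  have hs : (-1 : ℝ) ^ a.val = 1 ∨ (-1 : ℝ) ^ a.val = -1 := neg_one_pow_eq_or ℝ _
  have hw : ∀ p : ZMod n, ∃ w : ℝ, foldedX n θ p = foldedX n θ a + (-1) ^ a.val * w ∧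
      ∃ i i' : ZMod (n - k), z i ≤ w ∧ w ≤ z i' := by
    intro p
    have hp : p = a + ((p - a).val : ZMod n) := by rw [ZMod.natCast_zmod_val]; ring
    have hlt := ZMod.val_lt (p - a)
    by_cases hc : (p - a).val < n - k
    · refine ⟨z ((p - a).val : ZMod (n - k)), ?_, _, _, le_rfl, le_rfl⟩
      rw [← hzX, ZMod.val_natCast_of_lt hc, ← hp]
    · obtain ⟨t, ht⟩ : ∃ t, (p - a).val + k = n + t := ⟨(p - a).val + k - n, by omega⟩
      have hpt : p = m + (t : ZMod n) := by
        have h := congrArg (Nat.cast : ℕ → ZMod n) ht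
        push_cast at h
        rw [ZMod.natCast_self, ZMod.natCast_zmod_val, ha] at h
        linear_combination h
      have hal := erd_alt _ (hpos m).le t
      refine ⟨_, by rw [hpt, hrun t (by omega), hXa, hsa], 0, 1, ?_, ?_⟩
      · rw [hzv]; simpa using hal.2.1
      · have : Fact (1 < n - k) := ⟨hnk⟩
        rw [hzv, ZMod.val_one]
        simp only [Finset.sum_range_one, pow_zero, one_mul, Nat.cast_zero, add_zero, ha]
        exact hal.2.2.trans hrun₃.le
  apply le_antisymm
  · refine erd_sup_le 0 0 _ _ fun i j => ?_
    have h1 := hzX i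
    have h2 := hzX j
    rcases hs with h | h <;> rw [h] at h1 h2
    · exact ⟨a + (i.val : ZMod n), a + (j.val : ZMod n), by rw [h1, h2]; linarith⟩
    · exact ⟨a + (j.val : ZMod n), a + (i.val : ZMod n), by rw [h1, h2]; linarith⟩
  · refine erd_sup_le 0 0 _ _ fun p q => ?_
    obtain ⟨w, h1, i, i', h2, h3⟩ := hw p
    obtain ⟨v, h4, j, j', h5, h6⟩ := hw q
    rcases hs with h | h <;> rw [h] at h1 h4
    · exact ⟨i', j, by rw [h1, h4]; linarith⟩
    · exact ⟨j', i, by rw [h1, h4]; linarith⟩
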